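/- arXiv:1511.08189 — 2 statements merged into one kernel-verified Lean document; each statement's English description precedes it below -/
import Mathlib

section
/- Let Γ be a subgroup of Equiv.Perm (Fin n). For 0 ≤ i ≤ n let A_i be the pointwise stabilizer in Γ of {j : Fin n | (j : ℕ) < i}, let P_i = ∏_O |O|! where the product ranges over the orbits O of A_i acting on Fin n, and for 1 ≤ i ≤ n let m_i be the cardinality of the A_{i-1}-orbit of the point i-1. Then for every i with 0 ≤ i ≤ n, the following identity holds in ℚ: (n!/P_0) · (∏_{k=1}^{i} P_{k-1}/(m_k · P_k)) · P_i = (n!/|Γ|) · |A_i|. In particular, taking i = n, the total encoding range (n!/P_0) · ∏_{k=1}^{n} P_{k-1}/(m_k · P_k) equals n!/|Γ|. -/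
/-- The pointwise stabilizer of a set `S` in a subgroup `Γ` of `Equiv.Perm (Fin n)`:
the permutations in `Γ` fixing every point of `S`. -/
def pointwiseStab {n : ℕ} (Γ : Subgroup (Equiv.Perm (Fin n))) (S : Set (Fin n)) :
    Subgroup (Equiv.Perm (Fin n)) where
  carrier := {σ | σ ∈ Γ ∧ ∀ j ∈ S, σ j = j}
  mul_mem' := by
    rintro σ τ ⟨hσ, hσf⟩ ⟨hτ, hτf⟩
    exact ⟨Γ.mul_mem hσ hτ, fun j hj => by
      simp only [Equiv.Perm.mul_apply, hτf j hj, hσf j hj]⟩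
  one_mem' := ⟨Γ.one_mem, fun j _ => rfl⟩
  inv_mem' := by
    rintro σ ⟨hσ, hf⟩
    refine ⟨Γ.inv_mem hσ, fun j hj => ?_⟩
    exact σ.symm_apply_eq.mpr (hf j hj).symm

theorem pointwiseStab_empty {n : ℕ} (Γ : Subgroup (Equiv.Perm (Fin n))) :
    pointwiseStab Γ ∅ = Γ :=
  Subgroup.ext fun _ => ⟨fun h => h.1, fun h => ⟨h, fun _ hj => hj.elim⟩⟩

/-- The stabilizer of `v` inside the pointwise stabilizer of `S` is the pointwise stabilizer
of `insert v S`. -/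
def stabilizerEquivPointwiseStabInsert {n : ℕ} (Γ : Subgroup (Equiv.Perm (Fin n)))
    (S : Set (Fin n)) (v : Fin n) :
    MulAction.stabilizer (pointwiseStab Γ S) v ≃ pointwiseStab Γ (insert v S) where
  toFun σ := ⟨σ.1.1, σ.1.2.1, by
    rintro j (rfl | hj)
    · exact σ.2
    · exact σ.1.2.2 j hj⟩
  invFun σ := ⟨⟨σ.1, σ.2.1, fun j hj => σ.2.2 j (Or.inr hj)⟩, σ.2.2 v (Or.inl rfl)⟩

/-- Orbit-stabilizer for pointwise stabilizers. -/
theorem card_pointwiseStab_eq_card_orbit_mul {n : ℕ} (Γ : Subgroup (Equiv.Perm (Fin n)))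
    (S : Set (Fin n)) (v : Fin n) :
    Nat.card (pointwiseStab Γ S) =
      Nat.card (MulAction.orbit (pointwiseStab Γ S) v) *
        Nat.card (pointwiseStab Γ (insert v S)) := by
  rw [← Nat.card_congr (stabilizerEquivPointwiseStabInsert Γ S v), ← Nat.card_prod]
  exact Nat.card_congr (MulAction.orbitProdStabilizerEquivGroup _ v).symm

theorem insert_val_lt {n : ℕ} (v : Fin n) :
    insert v {j : Fin n | (j : ℕ) < v} = {j : Fin n | (j : ℕ) < v + 1} := by
  ext j
  simp only [Set.mem_insert_iff, Set.mem_ofPred_eq, Fin.ext_iff]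
  omega

/-- The telescoping identity behind the encoding of Lemma 4 (main technical lemma):
with `A i` the pointwise stabilizer of the first `i` points, `P i` the product of the
factorials of the `A i`-orbit sizes, and `m (k+1)` the size of the `A k`-orbit of the
point `k`, we have for all `i ≤ n`:
`(n!/P 0) · (∏_{k=1}^{i} P (k-1) / (m k · P k)) · P i = (n!/|Γ|) · |A i|` in `ℚ`. -/
theorem stmt_4 (n : ℕ) (Γ : Subgroup (Equiv.Perm (Fin n)))
    (A : ℕ → Subgroup (Equiv.Perm (Fin n)))
    (hA : ∀ i, A i = pointwiseStab Γ {j : Fin n | (j : ℕ) < i})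
    (P : ℕ → ℕ)
    (hP : ∀ i, P i =
      ∏ᶠ O : MulAction.orbitRel.Quotient (A i) (Fin n), (Nat.card O.orbit).factorial)
    (m : ℕ → ℕ)
    (hm : ∀ i : Fin n, m ((i : ℕ) + 1) = Nat.card (MulAction.orbit (A (i : ℕ)) i)) :
    ∀ i ≤ n,
      ((n.factorial : ℚ) / P 0) *
          (∏ k ∈ Finset.range i, (P k : ℚ) / ((m (k + 1) : ℚ) * P (k + 1))) * P i =
        ((n.factorial : ℚ) / Nat.card Γ) * Nat.card (A i) := by
  have hP0 (i : ℕ) : (P i : ℚ) ≠ 0 := by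
    have : Fintype (MulAction.orbitRel.Quotient (A i) (Fin n)) := Fintype.ofFinite _
    rw [Nat.cast_ne_zero, hP, finprod_eq_prod_of_fintype]
    exact Finset.prod_ne_zero_iff.mpr fun _ _ => Nat.factorial_ne_zero _
  intro i
  induction i with
  | zero =>
    intro _
    have hA0 : A 0 = Γ := by simp [hA, pointwiseStab_empty]
    have hΓ : (Nat.card Γ : ℚ) ≠ 0 := Nat.cast_ne_zero.mpr Nat.card_pos.ne'
    rw [hA0, Finset.prod_range_zero, mul_one, div_mul_cancel₀ _ (hP0 0), div_mul_cancel₀ _ hΓ]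
  | succ k ih =>
    intro hk
    have hcard : Nat.card (A k) = m (k + 1) * Nat.card (A (k + 1)) := by
      have h := card_pointwiseStab_eq_card_orbit_mul Γ {j : Fin n | (j : ℕ) < k} ⟨k, hk⟩
      have hins := insert_val_lt (⟨k, hk⟩ : Fin n)
      rw [hins, ← hA, ← hA] at h
      rw [h, ← hm ⟨k, hk⟩]
    have hm0 : (m (k + 1) : ℚ) ≠ 0 := by
      rw [Nat.cast_ne_zero]
      intro h0
      rw [h0, zero_mul] at hcard
      exact Nat.card_pos.ne' hcard
    have hrec := ih (Nat.le_of_succ_le hk)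
    rw [hcard, Nat.cast_mul] at hrec
    rw [Finset.prod_range_succ]
    apply mul_left_cancel₀ hm0
    rw [mul_left_comm (m (k + 1) : ℚ) (_ / _), ← hrec]
    have := hP0 (k + 1)
    field_simp
end

section
/- Let Γ be a subgroup of Equiv.Perm (Fin n), let v : Fin n, and let Δ be the stabilizer of v in Γ (the subgroup of elements of Γ fixing v). Then the product (size of the Γ-orbit of v) · ∏_B |B|!, where B ranges over the orbits of Δ on Fin n, divides ∏_O |O|!, where O ranges over the orbits of Γ on Fin n. -/
/-- If the fiber of `p` over `b₀` is a singleton, the product of the factorials of the fiber sizes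
of `p`, times the size of the fiber of `f ∘ p` over `f b₀`, divides the product of the factorials
of the fiber sizes of `f ∘ p`. -/
theorem card_fiber_mul_prod_factorial_dvd {α β γ : Type*} [Fintype α] [Fintype β] [Fintype γ]
    [DecidableEq β] [DecidableEq γ] (p : α → β) (f : β → γ) {b₀ : β}
    (h : Fintype.card {x // p x = b₀} = 1) :
    Fintype.card {x // f (p x) = f b₀} * ∏ b, (Fintype.card {x // p x = b}).factorial ∣
      ∏ c, (Fintype.card {x // f (p x) = c}).factorial := by
  have hsum (c : γ) : Fintype.card {x // f (p x) = c} =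
      ∑ b with f b = c, Fintype.card {x // p x = b} := by
    simp only [Fintype.card_subtype]
    rw [Finset.card_eq_sum_card_fiberwise (f := p) (t := {b | f b = c}) (by intro x; simp)]
    refine Finset.sum_congr rfl fun b hb => congrArg Finset.card ?_
    ext x
    simp only [Finset.mem_filter, Finset.mem_univ, true_and] at hb ⊢
    exact ⟨fun hx => hx.2, fun hx => ⟨hx ▸ hb, hx⟩⟩
  rw [← Finset.prod_fiberwise Finset.univ f, ← Finset.mul_prod_erase _ _ (Finset.mem_univ (f b₀)),
    ← Finset.mul_prod_erase Finset.univ (fun c => (Fintype.card {x // f (p x) = c}).factorial)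
      (Finset.mem_univ (f b₀)), ← mul_assoc]
  refine mul_dvd_mul ?_ (Finset.prod_dvd_prod_of_dvd _ _ fun c _ => ?_)
  · have hmem : b₀ ∈ ({b | f b = f b₀} : Finset β) := by simp
    have hcard := hsum (f b₀)
    rw [← Finset.add_sum_erase _ _ hmem, h, add_comm] at hcard
    rw [← Finset.mul_prod_erase _ _ hmem, h, Nat.factorial_one, one_mul, hcard,
      Nat.factorial_succ]
    exact mul_dvd_mul_left _ (Nat.prod_factorial_dvd_factorial_sum _ _)
  · rw [hsum]
    exact Nat.prod_factorial_dvd_factorial_sum _ _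

/-- For `Δ` the stabilizer of a point `v` in `Γ`, the product of the size of the `Γ`-orbit
of `v` with the product of the factorials of the `Δ`-orbit sizes divides the product of
the factorials of the `Γ`-orbit sizes. -/
theorem stmt_5 (n : ℕ) (Γ : Subgroup (Equiv.Perm (Fin n))) (v : Fin n)
    (Δ : Subgroup (Equiv.Perm (Fin n))) (hΔ : Δ = pointwiseStab Γ {v}) :
    (Nat.card (MulAction.orbit Γ v) *
        ∏ᶠ B : MulAction.orbitRel.Quotient Δ (Fin n), (Nat.card B.orbit).factorial) ∣
      ∏ᶠ O : MulAction.orbitRel.Quotient Γ (Fin n), (Nat.card O.orbit).factorial := by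
  classical
  have hΔΓ : Δ ≤ Γ := by
    subst hΔ
    exact fun σ hσ => hσ.1
  let f : MulAction.orbitRel.Quotient Δ (Fin n) → MulAction.orbitRel.Quotient Γ (Fin n) :=
    Quotient.map' id fun x y h => by
      obtain ⟨σ, rfl⟩ := h
      exact ⟨⟨σ, hΔΓ σ.2⟩, rfl⟩
  let p : Fin n → MulAction.orbitRel.Quotient Δ (Fin n) := Quotient.mk''
  have := Fintype.ofFinite (MulAction.orbitRel.Quotient Δ (Fin n))
  have := Fintype.ofFinite (MulAction.orbitRel.Quotient Γ (Fin n))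
  have hB (B : MulAction.orbitRel.Quotient Δ (Fin n)) :
      Nat.card B.orbit = Fintype.card {x // p x = B} := by
    rw [← Nat.card_eq_fintype_card]
    exact Nat.card_congr (Equiv.subtypeEquivRight fun x => MulAction.orbitRel.Quotient.mem_orbit)
  have hO (O : MulAction.orbitRel.Quotient Γ (Fin n)) :
      Nat.card O.orbit = Fintype.card {x // f (p x) = O} := by
    rw [← Nat.card_eq_fintype_card]
    exact Nat.card_congr (Equiv.subtypeEquivRight fun x => MulAction.orbitRel.Quotient.mem_orbit)
  have hv : Nat.card (MulAction.orbit Γ v) = Fintype.card {x // f (p x) = f (p v)} := by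
    rw [← hO]
    rfl
  have hpv : Fintype.card {x // p x = p v} = 1 := by
    refine Fintype.card_eq_one_iff.mpr ⟨⟨v, rfl⟩, fun ⟨x, hx⟩ => Subtype.ext ?_⟩
    obtain ⟨⟨σ, hσ⟩, rfl⟩ := Quotient.exact hx
    subst hΔ
    exact hσ.2 v rfl
  simp only [finprod_eq_prod_of_fintype, hv, hB, hO]
  exact card_fiber_mul_prod_factorial_dvd p f hpv
end
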